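/- arXiv:1408.5569 — 2 statements merged into one kernel-verified Lean document; each statement's English description precedes it below -/
import Mathlib

section
/- Let a, b, c, d be positive real numbers. Then a/b = c/d if and only if for all positive natural numbers n and m the following three equivalences hold: n·a > m·b if and only if n·c > m·d; n·a = m·b if and only if n·c = m·d; and n·a < m·b if and only if n·c < m·d. -/
/-- Unequal ratios of positive reals are separated by a pair of equimultiples. -/
theorem exists_equimultiples_of_div_lt_div {a b c d : ℝ} (ha : 0 < a) (hb : 0 < b) (hd : 0 < d)
    (h : a / b < c / d) :
    ∃ n m : ℕ, 0 < n ∧ 0 < m ∧ (n : ℝ) * a < (m : ℝ) * b ∧ (m : ℝ) * d < (n : ℝ) * c := by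
  obtain ⟨q, haq, hqc⟩ := exists_rat_btwn h
  have hq : 0 < q := by exact_mod_cast (div_pos ha hb).trans haq
  obtain ⟨m, hm⟩ := Int.eq_ofNat_of_zero_le (Rat.num_pos.2 hq).le
  have hm_pos : 0 < m := by
    have := Rat.num_pos.2 hq
    omega
  have hn : (0 : ℝ) < q.den := by exact_mod_cast q.den_pos
  have hqm : (q : ℝ) = m / q.den := by rw [Rat.cast_def, hm, Int.cast_natCast]
  rw [hqm] at haq hqc
  rw [div_lt_div_iff₀ hb hn] at haq
  rw [div_lt_div_iff₀ hn hd] at hqc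
  exact ⟨q.den, m, q.den_pos, hm_pos, by linarith, by linarith⟩

/-- Euclid's Definition V.5 (modern rendering): positive reals `a, b, c, d` satisfy
`a/b = c/d` iff for all positive naturals `n, m`, the equimultiples `n·a` and `n·c`
simultaneously exceed, equal, or fall short of `m·b` and `m·d`. -/
theorem euclid_def_V5 (a b c d : ℝ) (ha : 0 < a) (hb : 0 < b) (hc : 0 < c) (hd : 0 < d) :
    a / b = c / d ↔
      ∀ n m : ℕ, 0 < n → 0 < m →
        (((n : ℝ) * a > (m : ℝ) * b ↔ (n : ℝ) * c > (m : ℝ) * d) ∧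
         ((n : ℝ) * a = (m : ℝ) * b ↔ (n : ℝ) * c = (m : ℝ) * d) ∧
         ((n : ℝ) * a < (m : ℝ) * b ↔ (n : ℝ) * c < (m : ℝ) * d)) := by
  constructor
  · intro h n m hn _
    have hn' : (0 : ℝ) < n := by exact_mod_cast hn
    have gt_iff : ∀ {x y : ℝ}, 0 < y → ((n : ℝ) * x > m * y ↔ (m : ℝ) / n < x / y) := by
      intro x y hy
      rw [div_lt_div_iff₀ hn' hy, mul_comm x]
    have eq_iff : ∀ {x y : ℝ}, 0 < y → ((n : ℝ) * x = m * y ↔ x / y = (m : ℝ) / n) := by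
      intro x y hy
      rw [div_eq_div_iff hy.ne' hn'.ne', mul_comm x]
    have lt_iff : ∀ {x y : ℝ}, 0 < y → ((n : ℝ) * x < m * y ↔ x / y < (m : ℝ) / n) := by
      intro x y hy
      rw [div_lt_div_iff₀ hy hn', mul_comm x]
    simp only [gt_iff hb, gt_iff hd, eq_iff hb, eq_iff hd, lt_iff hb, lt_iff hd, h, and_self]
  · intro h
    rcases lt_trichotomy (a / b) (c / d) with hlt | heq | hgt
    · obtain ⟨n, m, hn, hm, h₁, h₂⟩ := exists_equimultiples_of_div_lt_div ha hb hd hlt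
      exact absurd ((h n m hn hm).2.2.1 h₁) h₂.not_gt
    · exact heq
    · obtain ⟨n, m, hn, hm, h₁, h₂⟩ := exists_equimultiples_of_div_lt_div hc hd hb hgt
      exact absurd ((h n m hn hm).2.2.2 h₁) h₂.not_gt
end

section
/- Let c > 0 and V > 0 be real numbers, and define g : ℝ → ℝ as the post-collision signed velocity that Descartes's rules assign to a body of size b arriving with speed V at a resting body of size c: g(b) = −V if b < c (Rule 4: the incoming body rebounds with its full speed), g(c) = −(3/4)·V (Rule 6: the incoming body rebounds at three quarters of its speed), and g(b) = b·V/(b + c) if b > c (Rule 5: it continues forward at speed V − (c/(b+c))·V). Then g is not continuous at b = c. -/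
/-- Descartes's rules 4, 5, 6 assign to a body of size `b` arriving with speed `V`
at a resting body of size `c` the post-collision velocity `g b`: `−V` if `b < c`,
`−(3/4)·V` if `b = c`, and `b·V/(b + c)` if `b > c`. This `g` is not continuous at `c`. -/
theorem descartes_incoming_body_discontinuous (c V : ℝ) (hc : 0 < c) (hV : 0 < V)
    (g : ℝ → ℝ)
    (hlt : ∀ b, b < c → g b = -V)
    (heq : g c = -(3 / 4) * V)
    (hgt : ∀ b, c < b → g b = b * V / (b + c)) :
    ¬ ContinuousAt g c := by
  intro h
  have left : Filter.Tendsto g (nhdsWithin c (Set.Iio c)) (nhds (-V)) :=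
    tendsto_const_nhds.congr' <| by
      filter_upwards [self_mem_nhdsWithin] with b hb using (hlt b hb).symm
  have hgc : g c = -V := tendsto_nhds_unique (h.tendsto.mono_left nhdsWithin_le_nhds) left
  linarith
end
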